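/- arXiv:1704.00262 — 3 statements merged into one kernel-verified Lean document; each statement's English description precedes it below -/
import Mathlib

section
/- (Uniqueness without the Lipschitz condition, case 𝕋 = ℝ.) Let f : ℝ → ℝ be continuous with f(x) > 0 for all x ∈ ℝ. If x, y : ℝ → ℝ are differentiable on an interval [a, b], satisfy x'(t) = f(x(t)) and y'(t) = f(y(t)) for all t ∈ [a, b], and x(t₀) = y(t₀) for some t₀ ∈ [a, b], then x(t) = y(t) for all t ∈ [a, b]. In particular, the Lipschitz condition is not necessary for uniqueness of solutions of the autonomous equation x' = f(x). -/
open Set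

/-- A positive continuous function `f` admits a strictly monotone antiderivative of `1 / f`. -/
theorem exists_strictMono_hasDerivAt_inv {f : ℝ → ℝ} (hf : Continuous f) (hfpos : ∀ x, 0 < f x) :
    ∃ G : ℝ → ℝ, StrictMono G ∧ ∀ u, HasDerivAt G (f u)⁻¹ u := by
  have hcont : Continuous fun u => (f u)⁻¹ := hf.inv₀ fun u => (hfpos u).ne'
  have hderiv (u : ℝ) : HasDerivAt (fun v => ∫ s in (0 : ℝ)..v, (f s)⁻¹) (f u)⁻¹ u :=
    hcont.integral_hasStrictDerivAt 0 u |>.hasDerivAt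
  refine ⟨_, strictMono_of_deriv_pos fun u => ?_, hderiv⟩
  rw [(hderiv u).deriv]
  exact inv_pos.2 (hfpos u)

/-- Uniqueness without the Lipschitz condition (case 𝕋 = ℝ): if `f : ℝ → ℝ`
is continuous and positive everywhere, then any two solutions of the
autonomous equation `x' = f(x)` on `[a, b]` which agree at some point
`t₀ ∈ [a, b]` coincide on all of `[a, b]`. -/
theorem uniqueness_without_lipschitz
    (f : ℝ → ℝ) (hf : Continuous f) (hfpos : ∀ x : ℝ, 0 < f x)
    (a b t₀ : ℝ) (x y : ℝ → ℝ)
    (hx : ∀ t ∈ Icc a b, HasDerivAt x (f (x t)) t)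
    (hy : ∀ t ∈ Icc a b, HasDerivAt y (f (y t)) t)
    (ht₀ : t₀ ∈ Icc a b) (hinit : x t₀ = y t₀) :
    ∀ t ∈ Icc a b, x t = y t := by
  obtain ⟨G, hG, hGderiv⟩ := exists_strictMono_hasDerivAt_inv hf hfpos
  have hcomp {z : ℝ → ℝ} {t : ℝ} (hz : HasDerivAt z (f (z t)) t) :
      HasDerivAt (fun s => G (z s)) 1 t := by
    simpa [Function.comp_def, inv_mul_cancel₀ (hfpos (z t)).ne'] using (hGderiv (z t)).comp t hz
  have hdiff : ∀ t ∈ Icc a b, HasDerivAt (fun s => G (x s) - G (y s)) 0 t := fun t ht => by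
    simpa using (hcomp (hx t ht)).fun_sub (hcomp (hy t ht))
  have hconst := constant_of_has_deriv_right_zero
    (fun t ht => (hdiff t ht).continuousAt.continuousWithinAt)
    (fun t ht => (hdiff t (Ico_subset_Icc_self ht)).hasDerivWithinAt)
  intro t ht
  have hzero : G (x t) - G (y t) = 0 := by
    rw [hconst t ht, ← hconst t₀ ht₀, hinit, sub_self]
  exact hG.injective (sub_eq_zero.1 hzero)
end

section
/- (Lemma 4.2, case 𝕋 = ℝ.) Assume: A : ℝ → L(ℝⁿ, ℝⁿ) is continuous; f : ℝ × ℝⁿ → ℝⁿ satisfies f(t, 0) = 0 and ‖f(t, x) − f(t, y)‖ ≤ L‖x − y‖ for all t, x, y (L > 0); y : ℝ → ℝⁿ is continuous on [−τ, ∞) and differentiable at every t > 0 with y'(t) = A(t)·y(t) + f(t, y(t − τ)); and the solution decays exponentially: ‖y(s)‖ ≤ M e^{−λ s} for all s ≥ −τ, with M, λ > 0. Then for every t ≥ 2τ, ‖y(t − τ) − y(γ_h(t − τ))‖ ≤ M e^{−λ t} e^{2λτ} ∫_{γ_h(t−τ)}^{t−τ} (‖A(s)‖ + L e^{λτ}) ds,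 where γ_h(t − τ) = (⌊t/h⌋ − k)·h. -/
open Set intervalIntegral

/-- Lemma 4.2 (case 𝕋 = ℝ): for the delay system
`y' = A(t) y + f(t, y(t − τ))` with `f(t,0)=0`, `f` Lipschitz with constant
`L`, and an exponentially decaying solution `‖y s‖ ≤ M e^{−λ s}`, the
deviation of `y` between `t − τ` and the piecewise constant argument
`γ_h(t − τ) = (⌊t/h⌋ − k) h` (step `h = τ/k`) satisfies, for `t ≥ 2τ`,
`‖y(t−τ) − y(γ_h(t−τ))‖ ≤ M e^{−λ t} e^{2λτ} ∫_{γ_h(t−τ)}^{t−τ} (‖A s‖ + L e^{λτ}) ds`. -/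
theorem depca_deviation_estimate
    {n : ℕ} (τ : ℝ) (hτ : 0 < τ) (k : ℕ) (hk : 1 ≤ k) (h : ℝ) (hh : h = τ / k)
    (A : ℝ → EuclideanSpace ℝ (Fin n) →L[ℝ] EuclideanSpace ℝ (Fin n))
    (hA : Continuous A)
    (L : ℝ) (hL : 0 < L)
    (f : ℝ → EuclideanSpace ℝ (Fin n) → EuclideanSpace ℝ (Fin n))
    (hf0 : ∀ t : ℝ, f t 0 = 0)
    (hflip : ∀ (t : ℝ) (x y : EuclideanSpace ℝ (Fin n)),
      ‖f t x - f t y‖ ≤ L * ‖x - y‖)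
    (y : ℝ → EuclideanSpace ℝ (Fin n))
    (hyc : ContinuousOn y (Ici (-τ)))
    (hyd : ∀ t > (0 : ℝ), HasDerivAt y (A t (y t) + f t (y (t - τ))) t)
    (M lam : ℝ) (hM : 0 < M) (hlam : 0 < lam)
    (hdecay : ∀ s ≥ -τ, ‖y s‖ ≤ M * Real.exp (-lam * s)) :
    ∀ t ≥ 2 * τ,
      ‖y (t - τ) - y (((⌊t / h⌋ - (k : ℤ) : ℤ) : ℝ) * h)‖ ≤
        M * Real.exp (-lam * t) * Real.exp (2 * lam * τ) *
          ∫ s in (((⌊t / h⌋ - (k : ℤ) : ℤ) : ℝ) * h)..(t - τ),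
            (‖A s‖ + L * Real.exp (lam * τ)) := by
  intro t ht
  have hk0 : (0 : ℝ) < k := by exact_mod_cast hk
  have hh0 : 0 < h := hh ▸ div_pos hτ hk0
  have hkh : k * h = τ := by rw [hh]; field_simp
  have hhτ : h ≤ τ := hh ▸ div_le_self hτ.le (by exact_mod_cast hk)
  have hfloor_ge : (2 * k : ℝ) ≤ ⌊t / h⌋ := by
    have : (2 * k : ℤ) ≤ ⌊t / h⌋ := by
      rw [Int.le_floor, le_div_iff₀ hh0]
      push_cast
      linarith
    exact_mod_cast this
  have hfloor_le : (⌊t / h⌋ : ℝ) * h ≤ t := (le_div_iff₀ hh0).1 (Int.floor_le _)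
  have hlt_floor : t < ((⌊t / h⌋ : ℝ) + 1) * h := (div_lt_iff₀ hh0).1 (Int.lt_floor_add_one _)
  set γ : ℝ := ((⌊t / h⌋ - (k : ℤ) : ℤ) : ℝ) * h with hγ
  have hγ_eq : γ = ⌊t / h⌋ * h - τ := by rw [hγ, ← hkh]; push_cast; ring
  have hτγ : τ ≤ γ := by nlinarith [mul_le_mul_of_nonneg_right hfloor_ge hh0.le]
  have hγ_le : γ ≤ t - τ := by linarith
  have ht_le : t - 2 * τ ≤ γ := by linarith
  have hg : Continuous fun s => ‖A s‖ + L * Real.exp (lam * τ) := hA.norm.add continuous_const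
  rw [← intervalIntegral.integral_const_mul]
  refine norm_sub_le_integral_of_norm_deriv_le_of_le hγ_le
    (hyc.mono fun s hs => mem_Ici.2 (by linarith [hs.1]))
    (fun s hs => (hyd s (by linarith [hs.1])).differentiableAt.differentiableWithinAt)
    (Filter.Eventually.of_forall fun s hs => ?_) ((hg.const_mul _).intervalIntegrable _ _)
  rw [(hyd s (by linarith [hs.1])).deriv]
  have hexp : Real.exp (-lam * s) ≤ Real.exp (-lam * t) * Real.exp (2 * lam * τ) := by
    rw [← Real.exp_add, Real.exp_le_exp]
    nlinarith [hs.1]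
  have hy : ‖y s‖ ≤ M * Real.exp (-lam * s) := hdecay s (by linarith [hs.1])
  have hy_delay : ‖y (s - τ)‖ ≤ M * Real.exp (-lam * s) * Real.exp (lam * τ) := by
    rw [mul_assoc, ← Real.exp_add]
    convert hdecay (s - τ) (by linarith [hs.1]) using 3
    ring
  have hf : ‖f s (y (s - τ))‖ ≤ L * ‖y (s - τ)‖ := by
    simpa [hf0] using hflip s (y (s - τ)) 0
  calc ‖A s (y s) + f s (y (s - τ))‖
      ≤ ‖A s‖ * ‖y s‖ + L * ‖y (s - τ)‖ := norm_add_le_of_le ((A s).le_opNorm _) hf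
    _ ≤ ‖A s‖ * (M * Real.exp (-lam * s))
          + L * (M * Real.exp (-lam * s) * Real.exp (lam * τ)) := by gcongr
    _ = M * Real.exp (-lam * s) * (‖A s‖ + L * Real.exp (lam * τ)) := by ring
    _ ≤ M * (Real.exp (-lam * t) * Real.exp (2 * lam * τ))
          * (‖A s‖ + L * Real.exp (lam * τ)) := by gcongr
    _ = M * Real.exp (-lam * t) * Real.exp (2 * lam * τ)
          * (‖A s‖ + L * Real.exp (lam * τ)) := by ring
end

section
/- (Theorem 4.1, variation-of-constants representation of the DEPCA solution, case 𝕋 = ℝ.) Let Φ be a transition matrix for A and let z solve the DEPCA with history η. Then for every n ∈ ℕ and every t ∈ [nh, (n+1)h], z(t) = Φ(t, 0)·η(0) + Σ_{i=0}^{n−1} ∫_{ih}^{(i+1)h} Φ(t, s)·f(s, z((i − k)h)) ds + ∫_{nh}^{t} Φ(t, s)·f(s, z((n − k)h)) ds. -/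
open Set intervalIntegral

/-- Two solutions of the operator equation `X' = A(t) ∘ X` which agree at one time are equal. -/
theorem eq_of_hasDerivAt_comp {E : Type*} [NormedAddCommGroup E] [NormedSpace ℝ E]
    {A X Y : ℝ → E →L[ℝ] E} (hA : Continuous A)
    (hX : ∀ t, HasDerivAt X ((A t).comp (X t)) t)
    (hY : ∀ t, HasDerivAt Y ((A t).comp (Y t)) t) {t₀ : ℝ} (h₀ : X t₀ = Y t₀) : X = Y := by
  ext1 t
  obtain ⟨a, b, ht, ht₀⟩ : ∃ a b, t ∈ Ioo a b ∧ t₀ ∈ Ioo a b :=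
    ⟨min t t₀ - 1, max t t₀ + 1, by grind, by grind⟩
  obtain ⟨C, hC⟩ := (isCompact_Icc (a := a) (b := b)).exists_bound_of_continuousOn hA.continuousOn
  refine ODE_solution_unique_of_mem_Ioo (K := C.toNNReal) (s := fun _ => univ)
    (v := fun t x => (A t).comp x) (fun u hu => ?_) ht₀
    (fun u _ => ⟨hX u, mem_univ _⟩) (fun u _ => ⟨hY u, mem_univ _⟩) h₀ ht
  refine LipschitzWith.lipschitzOnWith (LipschitzWith.of_dist_le_mul fun x y => ?_)
  rw [dist_eq_norm, dist_eq_norm, ← ContinuousLinearMap.comp_sub]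
  refine (ContinuousLinearMap.opNorm_comp_le _ _).trans ?_
  gcongr
  exact (hC u (Ioo_subset_Icc_self hu)).trans (Real.le_coe_toNNReal C)

/-- A transition operator factors as `Φ t s = Φ t 0 ∘ P s` for `s ≥ 0`, where `P` solves the
adjoint equation `P' = -P ∘ A`. -/
theorem exists_transition_factorization {E : Type*} [NormedAddCommGroup E] [NormedSpace ℝ E]
    [CompleteSpace E] {A : ℝ → E →L[ℝ] E} (hA : Continuous A) {Φ : ℝ → ℝ → E →L[ℝ] E}
    (hΦ : ∀ s ≥ (0 : ℝ), ∀ t : ℝ, HasDerivAt (fun u => Φ u s) ((A t).comp (Φ t s)) t)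
    (hid : ∀ s : ℝ, Φ s s = ContinuousLinearMap.id ℝ E) :
    ∃ P : ℝ → E →L[ℝ] E, P 0 = ContinuousLinearMap.id ℝ E ∧
      (∀ s ≥ (0 : ℝ), HasDerivAt P (-((P s).comp (A s))) s) ∧
      ∀ s ≥ (0 : ℝ), ∀ t, Φ t s = (Φ t 0).comp (P s) := by
  have hcomp : ∀ r ≥ (0 : ℝ), ∀ B : E →L[ℝ] E, ∀ t,
      HasDerivAt (fun u => (Φ u r).comp B) ((A t).comp ((Φ t r).comp B)) t := fun r hr B t => by
    simpa [ContinuousLinearMap.comp_assoc] using (hΦ r hr t).clm_comp (hasDerivAt_const t B)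
  have hleft : ∀ s ≥ (0 : ℝ), (Φ 0 s).comp (Φ s 0) = ContinuousLinearMap.id ℝ E := fun s hs => by
    have := eq_of_hasDerivAt_comp hA (hcomp s hs (Φ s 0)) (hΦ 0 le_rfl) (t₀ := s) (by
      simp [hid])
    simpa [hid] using congrFun this 0
  have hfac : ∀ s ≥ (0 : ℝ), ∀ t, (Φ t 0).comp (Φ 0 s) = Φ t s := fun s hs t =>
    congrFun (eq_of_hasDerivAt_comp hA (hcomp 0 le_rfl (Φ 0 s)) (hΦ s hs) (t₀ := 0) (by
      simp [hid])) t
  let U : ∀ s ≥ (0 : ℝ), (E →L[ℝ] E)ˣ := fun s hs =>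
    ⟨Φ s 0, Φ 0 s, (hfac s hs s).trans (hid s), hleft s hs⟩
  have hinv : ∀ s ≥ (0 : ℝ), Ring.inverse (Φ s 0) = Φ 0 s := fun s hs =>
    Ring.inverse_unit (U s hs)
  refine ⟨fun s => Ring.inverse (Φ s 0), ?_, fun s hs => ?_, fun s hs t => ?_⟩
  · exact (hinv 0 le_rfl).trans (hid 0)
  · have := (hasFDerivAt_ringInverse (𝕜 := ℝ) (U s hs)).comp_hasDerivAt s (hΦ 0 le_rfl s)
    convert! this using 1
    simp only [hinv s hs]
    change _ = -(((Φ 0 s).comp ((A s).comp (Φ s 0))).comp (Φ 0 s))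
    rw [ContinuousLinearMap.comp_assoc, ContinuousLinearMap.comp_assoc, hfac s hs s, hid,
      ContinuousLinearMap.comp_id]
  · simp only [hinv s hs, hfac s hs t]

/-- The variation-of-constants formula on one interval, in terms of a solution `P` of the adjoint
equation `P' = -P ∘ A`. -/
theorem integral_adjoint_apply_eq_sub {E : Type*} [NormedAddCommGroup E] [NormedSpace ℝ E]
    [CompleteSpace E] {A P : ℝ → E →L[ℝ] E} {g z : ℝ → E} {a b : ℝ} (hab : a ≤ b)
    (hP : ∀ s ∈ Icc a b, HasDerivAt P (-((P s).comp (A s))) s)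
    (hg : Continuous g) (hz : ContinuousOn z (Icc a b))
    (hz' : ∀ s ∈ Ioo a b, HasDerivAt z (A s (z s) + g s) s) :
    ∫ s in a..b, P s (g s) = P b (z b) - P a (z a) := by
  have hPc : ContinuousOn P (Icc a b) := HasDerivAt.continuousOn hP
  refine integral_eq_sub_of_hasDerivAt_of_le (f := fun s => P s (z s)) hab (hPc.clm_apply hz)
    (fun s hs => ?_) ((hPc.clm_apply hg.continuousOn).intervalIntegrable_of_Icc hab)
  simpa using (hP s (Ioo_subset_Icc_self hs)).clm_apply (hz' s hs)

/-- Theorem 4.1 (variation-of-constants representation of the DEPCA solution,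
case 𝕋 = ℝ): if `Φ` is a transition matrix for `A` and `z` solves the DEPCA
`z' = A(t) z + f(t, z((m − k) h))` on each `(mh, (m+1)h)` with history `η`,
then for every `m ∈ ℕ` and `t ∈ [mh, (m+1)h]`,
`z t = Φ(t,0) η(0) + Σ_{i=0}^{m−1} ∫_{ih}^{(i+1)h} Φ(t,s) f(s, z((i−k)h)) ds
      + ∫_{mh}^{t} Φ(t,s) f(s, z((m−k)h)) ds`. -/
theorem depca_variation_of_constants
    {n : ℕ} (τ : ℝ) (hτ : 0 < τ) (k : ℕ) (hk : 1 ≤ k) (h : ℝ) (hh : h = τ / k)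
    (A : ℝ → EuclideanSpace ℝ (Fin n) →L[ℝ] EuclideanSpace ℝ (Fin n))
    (hA : Continuous A)
    (f : ℝ → EuclideanSpace ℝ (Fin n) → EuclideanSpace ℝ (Fin n))
    (hf : Continuous fun p : ℝ × EuclideanSpace ℝ (Fin n) => f p.1 p.2)
    -- transition matrix Φ for A
    (Φ : ℝ → ℝ → EuclideanSpace ℝ (Fin n) →L[ℝ] EuclideanSpace ℝ (Fin n))
    (hΦderiv : ∀ s ≥ (0 : ℝ), ∀ t : ℝ,
      HasDerivAt (fun u => Φ u s) ((A t).comp (Φ t s)) t)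
    (hΦid : ∀ s : ℝ, Φ s s = ContinuousLinearMap.id ℝ (EuclideanSpace ℝ (Fin n)))
    (hΦcocycle : ∀ t s r : ℝ, 0 ≤ r → r ≤ s → s ≤ t → (Φ t s).comp (Φ s r) = Φ t r)
    -- history
    (η : ℝ → EuclideanSpace ℝ (Fin n)) (hη : ContinuousOn η (Icc (-τ) 0))
    -- z solves the DEPCA with history η
    (z : ℝ → EuclideanSpace ℝ (Fin n))
    (hzc : ContinuousOn z (Ici (-τ)))
    (hzhist : ∀ t ∈ Icc (-τ) (0 : ℝ), z t = η t)
    (hzd : ∀ m : ℕ, ∀ t ∈ Ioo ((m : ℝ) * h) (((m : ℝ) + 1) * h),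
      HasDerivAt z (A t (z t) + f t (z (((m : ℝ) - (k : ℝ)) * h))) t) :
    ∀ m : ℕ, ∀ t ∈ Icc ((m : ℝ) * h) (((m : ℝ) + 1) * h),
      z t = Φ t 0 (η 0) +
        (∑ i ∈ Finset.range m,
          ∫ s in ((i : ℝ) * h)..(((i : ℝ) + 1) * h),
            Φ t s (f s (z (((i : ℝ) - (k : ℝ)) * h)))) +
        ∫ s in ((m : ℝ) * h)..t,
          Φ t s (f s (z (((m : ℝ) - (k : ℝ)) * h))) := by

  obtain ⟨P, hP0, hP, hfac⟩ := exists_transition_factorization hA hΦderiv hΦid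
  have hh0 : 0 < h := by
    rw [hh]
    exact div_pos hτ (by exact_mod_cast hk)
  have hg : ∀ c, Continuous fun s => f s c := fun c => hf.comp (.prodMk_left c)
  have hstep : ∀ m : ℕ, ∀ t ∈ Icc ((m : ℝ) * h) (((m : ℝ) + 1) * h),
      ∫ s in ((m : ℝ) * h)..t, P s (f s (z (((m : ℝ) - (k : ℝ)) * h))) =
        P t (z t) - P (m * h) (z (m * h)) := fun m t ht => by
    have hm : 0 ≤ (m : ℝ) * h := by positivity
    exact integral_adjoint_apply_eq_sub ht.1 (fun s hs => hP s (hm.trans hs.1)) (hg _)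
      (hzc.mono fun s hs => by simp only [mem_Ici]; linarith [hs.1])
      (fun s hs => hzd m s ⟨hs.1, hs.2.trans_le ht.2⟩)
  have hnode : ∀ m : ℕ, P (m * h) (z (m * h)) = η 0 + ∑ i ∈ Finset.range m,
      ∫ s in ((i : ℝ) * h)..(((i : ℝ) + 1) * h), P s (f s (z (((i : ℝ) - (k : ℝ)) * h))) := by
    intro m
    induction m with
    | zero => simp [hP0, hzhist 0 ⟨by linarith, le_rfl⟩]
    | succ m ih =>
      rw [Finset.sum_range_succ, ← add_assoc, ← ih,
        hstep m _ ⟨by nlinarith, le_rfl⟩, Nat.cast_succ, add_sub_cancel]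
  have hpull : ∀ t a b : ℝ, 0 ≤ a → a ≤ b → ∀ c,
      ∫ s in a..b, Φ t s (f s c) = Φ t 0 (∫ s in a..b, P s (f s c)) := by
    intro t a b ha hab c
    have hPc : ContinuousOn P (Icc a b) := HasDerivAt.continuousOn fun s hs => hP s (ha.trans hs.1)
    rw [← (Φ t 0).intervalIntegral_comp_comm
      ((hPc.clm_apply (hg c).continuousOn).intervalIntegrable_of_Icc hab)]
    refine integral_congr fun s hs => ?_
    rw [uIcc_of_le hab] at hs
    simp [hfac s (ha.trans hs.1) t]
  intro m t ht
  have hm : 0 ≤ (m : ℝ) * h := by positivity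
  have ht0 : 0 ≤ t := hm.trans ht.1
  rw [hpull t _ _ hm ht.1, Finset.sum_congr rfl fun (i : ℕ) _ =>
      hpull t ((i : ℝ) * h) (((i : ℝ) + 1) * h) (by positivity) (by nlinarith) _,
    ← map_sum, ← map_add, ← map_add, ← hnode, hstep m t ht, add_sub_cancel,
    ← ContinuousLinearMap.comp_apply, ← hfac t ht0 t, hΦid, ContinuousLinearMap.id_apply]
end
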